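/- Fix integers k ≥ 1, L ≥ 2 and set N = (L+1)k. For each ℓ = 1,…,L let Σ_ℓ be a 2k×2k real symmetric positive-definite matrix. Let M be the N×N primal precision matrix obtained by summing the embeddings of the Σ_ℓ⁻¹ into coordinates (ℓ−1)k+1,…,(ℓ+1)k, and let M' be the (N−2k)×(N−2k) dual precision matrix obtained by summing the embeddings of D Σ_ℓ D (where D = diag(−I_k, I_k)) into coordinates (ℓ−1)k+1,…,(ℓ+1)k of ℝ^N and then restricting to the interior coordinates k+1,…,Lk (equivalently, setting the first k and last k coordinates to zero). Then det(M') = det(M) · ∏_{ℓ=1}^{L} det(Σ_ℓ); equivalently, with Σ = M⁻¹ and Σ' = M'⁻¹, det(Σ) = det(Σ') ∏_{ℓ=1}^{L} det(Σ_ℓ). -/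

import Mathlib

open Matrix MeasureTheory Real

/-- Embedding of a `2k × 2k` matrix into an `N × N` matrix (`N = (L+1)k`),
occupying the coordinates `ℓk, …, ℓk + 2k - 1` of block `ℓ` (0-indexed,
corresponding to coordinates `(ℓ−1)k+1, …, (ℓ+1)k` in 1-indexed notation). -/
noncomputable def embed (k L : ℕ) (ℓ : Fin L) (A : Matrix (Fin (2*k)) (Fin (2*k)) ℝ) :
    Matrix (Fin ((L+1)*k)) (Fin ((L+1)*k)) ℝ :=
  Matrix.of fun i j =>
    if h : (ℓ:ℕ)*k ≤ (i:ℕ) ∧ (i:ℕ) < (ℓ:ℕ)*k + 2*k ∧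
           (ℓ:ℕ)*k ≤ (j:ℕ) ∧ (j:ℕ) < (ℓ:ℕ)*k + 2*k then
      A ⟨(i:ℕ) - (ℓ:ℕ)*k, by omega⟩ ⟨(j:ℕ) - (ℓ:ℕ)*k, by omega⟩
    else 0

/-- The sign-inversion matrix `D = diag(−I_k, I_k)` acting on a block of `2k`
variables: the `k` variables shared with the previous block enter with a minus
sign. -/
noncomputable def signD (k : ℕ) : Matrix (Fin (2*k)) (Fin (2*k)) ℝ :=
  Matrix.diagonal fun i => if (i:ℕ) < k then -1 else 1

/-- The inclusion of the `(L−1)k` interior coordinates `k, …, Lk − 1`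
(0-indexed; `k+1, …, Lk` in 1-indexed notation) into all `(L+1)k` coordinates. -/
def interiorIdx (k L : ℕ) (i : Fin ((L-1)*k)) : Fin ((L+1)*k) :=
  ⟨k + (i:ℕ), by
    have h1 : (i:ℕ) < (L-1)*k := i.isLt
    have h2 : (1 + (L-1)) * k ≤ (L+1) * k := Nat.mul_le_mul_right k (by omega)
    have h3 : (1 + (L-1)) * k = k + (L-1)*k := by ring
    omega⟩

/-- If the columns of `A` and of `B` span complementary orthogonal subspaces, the Gram determinants
of `A` with respect to `S⁻¹` and of `B` with respect to `S` are related by `det S`. -/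
lemma det_mul_det_gram_of_orthogonal {n p q : Type*} [Fintype n] [DecidableEq n] [Fintype p]
    [DecidableEq p] [Fintype q] [DecidableEq q] (e : p ⊕ q ≃ n) (A : Matrix n p ℝ)
    (B : Matrix n q ℝ) (S : Matrix n n ℝ) (hS : IsUnit S.det) (hAB : Aᵀ * B = 0) :
    (Aᵀ * A).det * (Bᵀ * S * B).det = S.det * ((Aᵀ * S⁻¹ * A).det * (Bᵀ * B).det) := by
  have hBA : Bᵀ * A = 0 := by simpa using congrArg Matrix.transpose hAB
  have h1 : (fromCols A B)ᵀ * fromCols A (S * B) =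
      fromBlocks (Aᵀ * A) (Aᵀ * (S * B)) 0 (Bᵀ * S * B) := by
    rw [transpose_fromCols, fromRows_mul_fromCols, hBA, Matrix.mul_assoc]
  have h2 : (fromCols A B)ᵀ * fromCols (S⁻¹ * A) B =
      fromBlocks (Aᵀ * S⁻¹ * A) 0 (Bᵀ * (S⁻¹ * A)) (Bᵀ * B) := by
    rw [transpose_fromCols, fromRows_mul_fromCols, hAB, Matrix.mul_assoc]
  have h3 : fromCols A (S * B) = S * fromCols (S⁻¹ * A) B := by
    rw [mul_fromCols, Matrix.mul_nonsing_inv_cancel_left _ _ hS]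
  have h4 (X : Matrix n (p ⊕ q) ℝ) : ((fromCols A B)ᵀ * X).det =
      ((fromCols A B)ᵀ.submatrix id e).det * (X.submatrix e id).det := by
    rw [← det_mul, submatrix_mul_equiv, submatrix_id_id]
  have h5 : (S * fromCols (S⁻¹ * A) B).submatrix e id =
      S.submatrix e e * (fromCols (S⁻¹ * A) B).submatrix e id := by
    rw [submatrix_mul_equiv]
  rw [← det_fromBlocks_zero₁₂ (Aᵀ * S⁻¹ * A) (Bᵀ * (S⁻¹ * A)),
    ← det_fromBlocks_zero₂₁ (Aᵀ * A) (Aᵀ * (S * B)), ← h1, ← h2, h4, h4, h3, h5, det_mul, det_submatrix_equiv_self]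
  ring

/-- The matrix sending a vector in `ℝ^N` to the family of its restrictions to the `L` overlapping
windows of length `2k`. -/
noncomputable def windowMatrix (k L : ℕ) :
    Matrix (Fin (2*k) × Fin L) (Fin ((L+1)*k)) ℝ :=
  Matrix.of fun p j => if (j:ℕ) = (p.2:ℕ)*k + p.1 then 1 else 0

/-- The sign-inverted window restriction of vectors supported on the interior coordinates. -/
noncomputable def dualWindowMatrix (k L : ℕ) :
    Matrix (Fin (2*k) × Fin L) (Fin ((L-1)*k)) ℝ :=
  (blockDiagonal fun _ : Fin L => signD k) * (windowMatrix k L).submatrix id (interiorIdx k L)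

lemma dualWindowMatrix_apply (k L : ℕ) (p : Fin (2*k) × Fin L) (i : Fin ((L-1)*k)) :
    dualWindowMatrix k L p i =
      if k + (i:ℕ) = (p.2:ℕ)*k + p.1 then (if (p.1:ℕ) < k then -1 else 1) else 0 := by
  simp only [dualWindowMatrix, signD]
  rw [blockDiagonal_diagonal, diagonal_mul]
  simp [windowMatrix, interiorIdx]

lemma sum_fin_ite_eq_add (n s t : ℕ) (f : ℕ → ℝ) :
    ∑ a : Fin n, (if s = t + (a:ℕ) then f a else 0) =
      if t ≤ s ∧ s < t + n then f (s - t) else 0 := by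
  rw [Fin.sum_univ_eq_sum_range (fun a => if s = t + a then f a else 0) n]
  split_ifs with h
  · rw [Finset.sum_eq_single (s - t)]
    · rw [if_pos (by omega)]
    · intro b _ hb
      rw [if_neg (by omega)]
    · intro hs
      rw [Finset.mem_range] at hs
      omega
  · refine Finset.sum_eq_zero fun a ha => if_neg ?_
    rw [Finset.mem_range] at ha
    omega

lemma sum_embed_eq (k L : ℕ) (X : Fin L → Matrix (Fin (2*k)) (Fin (2*k)) ℝ) :
    ∑ ℓ : Fin L, embed k L ℓ (X ℓ) =
      (windowMatrix k L)ᵀ * blockDiagonal X * windowMatrix k L := by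
  ext i j
  have hsum (ℓ : Fin L) : embed k L ℓ (X ℓ) i j = ∑ b : Fin (2*k), ∑ a : Fin (2*k),
      (if (i:ℕ) = ℓ*k + a then 1 else 0) * X ℓ a b * (if (j:ℕ) = ℓ*k + b then 1 else 0) := by
    simp only [embed, of_apply]
    split_ifs with h
    · rw [Finset.sum_eq_single ⟨(j:ℕ) - ℓ*k, by omega⟩,
        Finset.sum_eq_single ⟨(i:ℕ) - ℓ*k, by omega⟩]
      · rw [if_pos (by dsimp only; omega), if_pos (by dsimp only; omega)]
        ring
      · intro a _ ha
        rw [if_neg (fun h' => ha (Fin.ext (by dsimp only; omega)))]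
        ring
      · simp
      · intro b _ hb
        refine Finset.sum_eq_zero fun a _ => ?_
        rw [if_neg (c := (j:ℕ) = _) (fun h' => hb (Fin.ext (by dsimp only; omega)))]
        ring
      · simp
    · symm
      refine Finset.sum_eq_zero fun b _ => Finset.sum_eq_zero fun a _ => ?_
      have ha := a.isLt
      have hb := b.isLt
      by_cases h1 : (i:ℕ) = ℓ*k + a
      · rw [if_neg (c := (j:ℕ) = _) (fun h2 => h (by omega))]
        ring
      · rw [if_neg h1]
        ring
  rw [Matrix.sum_apply, Finset.sum_congr rfl fun ℓ _ => hsum ℓ]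
  simp only [Matrix.mul_apply, Fintype.sum_prod_type, transpose_apply, windowMatrix, of_apply,
    blockDiagonal_apply, Finset.sum_mul]
  rw [Finset.sum_comm]
  refine Finset.sum_congr rfl fun b _ => Finset.sum_congr rfl fun ℓ _ =>
    Finset.sum_congr rfl fun a _ => ?_
  rw [Finset.sum_eq_single ℓ]
  · simp
  · intro m _ hm
    simp [hm]
  · simp

lemma sum_window_ite (k L : ℕ) (hk : 1 ≤ k) (s : ℕ) (x y : ℝ) :
    ∑ p : Fin (2*k) × Fin L,
      (if s = (p.2:ℕ)*k + p.1 then (if (p.1:ℕ) < k then x else y) else 0) =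
      (if s < L*k then x else 0) + (if k ≤ s ∧ s < (L+1)*k then y else 0) := by
  have hdiv (m : ℕ) : (m*k ≤ s ∧ s < m*k + k) ↔ s / k = m := by
    rw [Nat.div_eq_iff (by omega)]
    constructor <;> intro h <;> constructor <;> omega
  have hx : s < L*k ↔ s / k < L := (Nat.div_lt_iff_lt_mul hk).symm
  have hy : (k ≤ s ∧ s < (L+1)*k) ↔ (1 ≤ s / k ∧ s / k < L + 1) := by
    rw [Nat.div_lt_iff_lt_mul hk, Nat.le_div_iff_mul_le hk, one_mul]
  have hℓ (ℓ : ℕ) : (∑ a : Fin (2*k), if s = ℓ*k + a then (if (a:ℕ) < k then x else y) else 0) =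
      (if s / k = 0 + ℓ then x else 0) + (if s / k = 1 + ℓ then y else 0) := by
    rw [sum_fin_ite_eq_add (2*k) s (ℓ*k) fun a => if a < k then x else y]
    have h0 := hdiv ℓ
    have h1 := hdiv (1 + ℓ)
    rw [show (1 + ℓ)*k = ℓ*k + k by ring] at h1
    rw [zero_add]
    simp only [← h0, ← h1]
    split_ifs <;> first | omega | simp
  rw [Fintype.sum_prod_type_right]
  simp only [hℓ, Finset.sum_add_distrib, hx, hy]
  rw [sum_fin_ite_eq_add L (s / k) 0 fun _ => x, sum_fin_ite_eq_add L (s / k) 1 fun _ => y]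
  simp [add_comm]

lemma windowMatrix_transpose_mul_dualWindowMatrix (k L : ℕ) (hk : 1 ≤ k) :
    (windowMatrix k L)ᵀ * dualWindowMatrix k L = 0 := by
  ext j i
  simp only [Matrix.mul_apply, transpose_apply, dualWindowMatrix_apply, windowMatrix, of_apply]
  by_cases h : (j:ℕ) = k + i
  · have hs := sum_window_ite k L hk j (-1) 1
    have hi : (i:ℕ) < (L-1)*k := i.isLt
    have hL : 1 ≤ L := by
      by_contra hL
      simp [show L = 0 by omega] at hi
    obtain ⟨m, rfl⟩ := Nat.exists_eq_add_of_le' hL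
    simp only [Nat.add_sub_cancel] at hi
    have hm : (m+1)*k = m*k + k := by ring
    have hm' : (m+1+1)*k = m*k + k + k := by ring
    rw [if_pos (by omega), if_pos (by omega)] at hs
    rw [neg_add_cancel] at hs
    rw [Matrix.zero_apply, ← h]
    refine (Finset.sum_congr rfl fun p _ => ?_).trans hs
    split_ifs <;> norm_num
  · refine Finset.sum_eq_zero fun p _ => ?_
    by_cases h' : (j:ℕ) = p.2*k + p.1
    · rw [if_neg (c := k + (i:ℕ) = _) (by omega), mul_zero]
    · rw [if_neg h', zero_mul]

lemma dualWindowMatrix_transpose_mul_self (k L : ℕ) (hk : 1 ≤ k) :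
    (dualWindowMatrix k L)ᵀ * dualWindowMatrix k L = diagonal fun _ => 2 := by
  ext i j
  simp only [Matrix.mul_apply, transpose_apply, dualWindowMatrix_apply]
  by_cases h : i = j
  · subst h
    have hs := sum_window_ite k L hk (k + i) 1 1
    have hi : (i:ℕ) < (L-1)*k := i.isLt
    have hL : 1 ≤ L := by
      by_contra hL
      simp [show L = 0 by omega] at hi
    obtain ⟨m, rfl⟩ := Nat.exists_eq_add_of_le' hL
    simp only [Nat.add_sub_cancel] at hi
    have hm : (m+1)*k = m*k + k := by ring
    have hm' : (m+1+1)*k = m*k + k + k := by ring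
    rw [if_pos (by omega), if_pos (by omega)] at hs
    rw [diagonal_apply_eq, show (2:ℝ) = 1 + 1 by norm_num, ← hs]
    refine Finset.sum_congr rfl fun p _ => ?_
    split_ifs <;> norm_num
  · rw [diagonal_apply_ne _ h]
    refine Finset.sum_eq_zero fun p _ => ?_
    by_cases h' : k + (i:ℕ) = p.2*k + p.1
    · rw [if_neg (c := k + (j:ℕ) = _) (fun h'' => h (Fin.ext (by omega))), mul_zero]
    · rw [if_neg h', zero_mul]

lemma windowMatrix_transpose_mul_self (k L : ℕ) (hk : 1 ≤ k) :
    (windowMatrix k L)ᵀ * windowMatrix k L = diagonal fun j : Fin ((L+1)*k) =>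
      (if (j:ℕ) < L*k then 1 else 0) + (if k ≤ (j:ℕ) then 1 else 0) := by
  ext i j
  simp only [Matrix.mul_apply, transpose_apply, windowMatrix, of_apply]
  by_cases h : i = j
  · subst h
    have hs := sum_window_ite k L hk i 1 1
    simp only [i.isLt, and_true] at hs
    rw [diagonal_apply_eq, ← hs]
    refine Finset.sum_congr rfl fun p _ => ?_
    split_ifs <;> norm_num
  · rw [diagonal_apply_ne _ h]
    refine Finset.sum_eq_zero fun p _ => ?_
    by_cases h' : (i:ℕ) = p.2*k + p.1
    · rw [if_neg (c := (j:ℕ) = _) (fun h'' => h (Fin.ext (by omega))), mul_zero]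
    · rw [if_neg h', zero_mul]

lemma det_windowMatrix_transpose_mul_self (k L : ℕ) (hk : 1 ≤ k) (hL : 1 ≤ L) :
    ((windowMatrix k L)ᵀ * windowMatrix k L).det = 2 ^ ((L-1)*k) := by
  obtain ⟨m, rfl⟩ := Nat.exists_eq_add_of_le' hL
  rw [windowMatrix_transpose_mul_self k _ hk, det_diagonal,
    Fin.prod_univ_eq_prod_range (fun j => (if j < (m+1)*k then (1:ℝ) else 0) +
      (if k ≤ j then 1 else 0)), show (m+1+1)*k = k + m*k + k by ring,
    show (m+1)*k = k + m*k by ring, Finset.prod_range_add, Finset.prod_range_add,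
    Nat.add_sub_cancel]
  have h1 : ∏ j ∈ Finset.range k, ((if j < k + m*k then (1:ℝ) else 0) +
      (if k ≤ j then 1 else 0)) = 1 := by
    refine Finset.prod_eq_one fun j hj => ?_
    rw [Finset.mem_range] at hj
    rw [if_pos (by omega), if_neg (by omega), add_zero]
  have h2 : ∏ j ∈ Finset.range (m*k), ((if k + j < k + m*k then (1:ℝ) else 0) +
      (if k ≤ k + j then 1 else 0)) = 2 ^ (m*k) := by
    rw [Finset.prod_congr rfl (g := fun _ => (2:ℝ)), Finset.prod_const, Finset.card_range]
    intro j hj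
    rw [Finset.mem_range] at hj
    rw [if_pos (by omega), if_pos (by omega)]
    norm_num
  have h3 : ∏ j ∈ Finset.range k, ((if k + m*k + j < k + m*k then (1:ℝ) else 0) +
      (if k ≤ k + m*k + j then 1 else 0)) = 1 := by
    refine Finset.prod_eq_one fun j _ => ?_
    rw [if_neg (by omega), if_pos (by omega), zero_add]
  rw [h1, h2, h3, one_mul, mul_one]

/-- **Duality relation between the primal and dual precision matrices of the
Gaussian ladder graph.**  With `M` the primal precision matrix (sum of the
embedded `(Sigl ℓ)⁻¹`) and `M'` the dual precision matrix (sum of the embedded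
`D (Sigl ℓ) D` restricted to the interior coordinates), one has
`det M' = det M · ∏ℓ det (Sigl ℓ)`; equivalently, with `Σ = M⁻¹` and
`Σ' = M'⁻¹`, `det Σ = det Σ' · ∏ℓ det (Sigl ℓ)`. -/
theorem det_dual_precision_eq (k L : ℕ) (hk : 1 ≤ k) (hL : 2 ≤ L)
    (Sigl : Fin L → Matrix (Fin (2*k)) (Fin (2*k)) ℝ) (hSigl : ∀ ℓ, (Sigl ℓ).PosDef)
    (M : Matrix (Fin ((L+1)*k)) (Fin ((L+1)*k)) ℝ)
    (hM : M = ∑ ℓ : Fin L, embed k L ℓ (Sigl ℓ)⁻¹)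
    (M' : Matrix (Fin ((L-1)*k)) (Fin ((L-1)*k)) ℝ)
    (hM' : M' = (∑ ℓ : Fin L, embed k L ℓ (signD k * Sigl ℓ * signD k)).submatrix
                  (interiorIdx k L) (interiorIdx k L)) :
    M'.det = M.det * ∏ ℓ : Fin L, (Sigl ℓ).det ∧
    (M⁻¹).det = (M'⁻¹).det * ∏ ℓ : Fin L, (Sigl ℓ).det := by
  have hdet (ℓ : Fin L) : IsUnit (Sigl ℓ).det := (hSigl ℓ).det_pos.ne'.isUnit
  have hSdet : (blockDiagonal Sigl).det = ∏ ℓ : Fin L, (Sigl ℓ).det := det_blockDiagonal Sigl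
  have hS : IsUnit (blockDiagonal Sigl).det := by
    rw [hSdet]
    exact (Finset.prod_pos fun ℓ _ => (hSigl ℓ).det_pos).ne'.isUnit
  have hinv : (blockDiagonal fun ℓ => (Sigl ℓ)⁻¹) = (blockDiagonal Sigl)⁻¹ := by
    symm
    apply inv_eq_right_inv
    rw [← blockDiagonal_mul]
    simp only [fun ℓ => mul_nonsing_inv _ (hdet ℓ)]
    exact blockDiagonal_one
  have hMA : M = (windowMatrix k L)ᵀ * (blockDiagonal Sigl)⁻¹ * windowMatrix k L := by
    rw [hM, sum_embed_eq k L fun ℓ => (Sigl ℓ)⁻¹, hinv]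
  have hMB : M' = (dualWindowMatrix k L)ᵀ * blockDiagonal Sigl * dualWindowMatrix k L := by
    have hD : (signD k)ᵀ = signD k := diagonal_transpose _
    rw [hM', sum_embed_eq k L fun ℓ => signD k * Sigl ℓ * signD k, blockDiagonal_mul,
      blockDiagonal_mul, dualWindowMatrix, transpose_mul, blockDiagonal_transpose, hD,
      transpose_submatrix]
    simp only [Matrix.mul_assoc]
    rw [submatrix_mul _ _ _ id _ Function.bijective_id]
    congr 1
  have hcard : Fintype.card (Fin ((L+1)*k) ⊕ Fin ((L-1)*k)) =
      Fintype.card (Fin (2*k) × Fin L) := by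
    obtain ⟨m, rfl⟩ := Nat.exists_eq_add_of_le' (show 1 ≤ L by omega)
    simp only [Fintype.card_sum, Fintype.card_prod, Fintype.card_fin, Nat.add_sub_cancel]
    ring
  have hkey := det_mul_det_gram_of_orthogonal (Fintype.equivOfCardEq hcard) (windowMatrix k L)
    (dualWindowMatrix k L) (blockDiagonal Sigl) hS
    (windowMatrix_transpose_mul_dualWindowMatrix k L hk)
  rw [← hMA, ← hMB, det_windowMatrix_transpose_mul_self k L hk (by omega),
    dualWindowMatrix_transpose_mul_self k L hk, det_diagonal, Finset.prod_const, Finset.card_univ,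
    Fintype.card_fin, hSdet] at hkey
  have hmain : M'.det = M.det * ∏ ℓ : Fin L, (Sigl ℓ).det := by
    have h2 : (2:ℝ) ^ ((L-1)*k) ≠ 0 := by positivity
    apply mul_left_cancel₀ h2
    linear_combination hkey
  refine ⟨hmain, ?_⟩
  rw [det_nonsing_inv, det_nonsing_inv, Ring.inverse_eq_inv', hmain, mul_inv, mul_assoc,
    inv_mul_cancel₀ (hSdet ▸ hS.ne_zero), mul_one]
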